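/- For every complex number s with Re(s) > 1, the function p₁ satisfies the functional equation p₁(2s) = p₁(s)² · q₁(s), where q₁(s) = ζ(2s)/(ζ(s)L(s,χ)) · ∏_{p prime, p|d} (1 + p^{-s}). -/

import Mathlib

open Complex NumberField Filter

noncomputable section

/-- The partial Euler product `∏_{p prime, χ(p) = ε} (1 - p^{-s})⁻¹`. -/
def eulerProd {d : ℕ} (χ : DirichletCharacter ℂ d) (ε : ℂ) (s : ℂ) : ℂ :=
  ∏' p : {p : Nat.Primes // χ ((p : Nat.Primes) : ℕ) = ε}, (1 - (((p : Nat.Primes) : ℕ) : ℂ) ^ (-s))⁻¹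

/-- `χ` is the Dirichlet character attached to the quadratic field `K`, i.e. the real
primitive quadratic character mod `d = |Δ_K|` given by the Kronecker symbol `(Δ_K/·)`:
at odd primes it is given by the Legendre symbol `(Δ_K/p)` and at `2` (when `2 ∤ d`)
by `χ₈(Δ_K)`. -/
def IsKroneckerCharacter (K : Type*) [Field K] [NumberField K] {d : ℕ}
    (χ : DirichletCharacter ℂ d) : Prop :=
  d = (NumberField.discr K).natAbs ∧ χ.IsPrimitive ∧ MulChar.IsQuadratic χ ∧
  (∀ (p : ℕ) (hp : p.Prime), p ≠ 2 →
    χ (p : ZMod d) = ((@legendreSym p ⟨hp⟩ (NumberField.discr K) : ℤ) : ℂ)) ∧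
  (¬ (2 : ℕ) ∣ d → χ ((2 : ℕ) : ZMod d) = ((ZMod.χ₈ ((NumberField.discr K : ℤ) : ZMod 8) : ℤ) : ℂ))

/-- `q₁(s) = ζ(2s)/(ζ(s)L(s,χ)) ∏_{p|d} (1+p^{-s})`. -/
def qOne {d : ℕ} [NeZero d] (χ : DirichletCharacter ℂ d) (s : ℂ) : ℂ :=
  riemannZeta (2 * s) / (riemannZeta s * DirichletCharacter.LFunction χ s) *
    ∏ p ∈ d.primeFactors, (1 + (p : ℂ) ^ (-s))

/-- `q₂(s) = L(s,χ)/ζ(s) ∏_{p|d} (1-p^{-s})⁻¹`. -/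
def qTwo {d : ℕ} [NeZero d] (χ : DirichletCharacter ℂ d) (s : ℂ) : ℂ :=
  DirichletCharacter.LFunction χ s / riemannZeta s *
    ∏ p ∈ d.primeFactors, (1 - (p : ℂ) ^ (-s))⁻¹

/-- The terms `p ^ (-s)` of the prime Dirichlet series have norm at most `1 / 2` for `Re s > 1`. -/
lemma norm_prime_cpow_neg_le_half (p : Nat.Primes) {s : ℂ} (hs : 1 < s.re) :
    ‖((p : ℕ) : ℂ) ^ (-s)‖ ≤ 1 / 2 := by
  rw [norm_natCast_cpow_of_pos p.2.pos, neg_re]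
  have h2 : (2 : ℝ) ≤ (p : ℕ) := by exact_mod_cast p.2.two_le
  calc ((p : ℕ) : ℝ) ^ (-s.re) ≤ ((p : ℕ) : ℝ) ^ (-1 : ℝ) :=
        Real.rpow_le_rpow_of_exponent_le (by linarith) (by linarith)
    _ = ((p : ℕ) : ℝ)⁻¹ := Real.rpow_neg_one _
    _ ≤ 1 / 2 := by rw [one_div]; gcongr

/-- The partial Euler product `eulerProd χ ε s` is convergent, as a product over all primes. -/
lemma hasProd_eulerProd {d : ℕ} (χ : DirichletCharacter ℂ d) (ε : ℂ) {s : ℂ} (hs : 1 < s.re) :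
    HasProd (Set.mulIndicator {p : Nat.Primes | χ (p : ℕ) = ε}
      fun p ↦ (1 - ((p : ℕ) : ℂ) ^ (-s))⁻¹) (eulerProd χ ε s) := by
  set S := {p : Nat.Primes | χ (p : ℕ) = ε}
  set f := fun p : Nat.Primes ↦ (1 - ((p : ℕ) : ℂ) ^ (-s))⁻¹
  have hsum : Summable fun p : Nat.Primes ↦ 2 * ‖((p : ℕ) : ℂ) ^ (-s)‖ := by
    refine Summable.mul_left 2 ?_
    have := Nat.Primes.summable_rpow.mpr (show -s.re < -1 by linarith)
    refine this.congr fun p ↦ ?_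
    rw [norm_natCast_cpow_of_pos p.2.pos, neg_re]
  have hmul : Multipliable (S.mulIndicator f) := by
    have : Summable fun p ↦ ‖S.mulIndicator f p - 1‖ := by
      refine hsum.of_nonneg_of_le (fun _ ↦ norm_nonneg _) fun p ↦ ?_
      by_cases hp : p ∈ S
      · rw [Set.mulIndicator_of_mem hp]
        have hx := norm_prime_cpow_neg_le_half p hs
        simp only [f]
        set x := ((p : ℕ) : ℂ) ^ (-s)
        have h1 : 1 / 2 ≤ ‖1 - x‖ := by
          have := norm_sub_norm_le 1 x
          rw [norm_one] at this
          linarith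
        have h0 : 1 - x ≠ 0 := norm_pos_iff.mp (by linarith)
        rw [show (1 - x)⁻¹ - 1 = x / (1 - x) by field_simp; ring, norm_div,
          div_le_iff₀ (by linarith)]
        nlinarith [norm_nonneg x]
      · rw [Set.mulIndicator_of_notMem hp]
        simp
    simpa using multipliable_one_add_of_summable this
  rw [show eulerProd χ ε s = ∏' p, S.mulIndicator f p from tprod_subtype S f]
  exact hmul.hasProd

/-- The finite product `∏_{p ∣ d} f p` as a product over all primes. -/
lemma hasProd_primeFactors {d : ℕ} [NeZero d] (f : ℕ → ℂ) :
    HasProd (Set.mulIndicator {p : Nat.Primes | (p : ℕ) ∣ d} fun p ↦ f p)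
      (∏ p ∈ d.primeFactors, f p) := by
  have h : ∏ p ∈ d.primeFactors.subtype Nat.Prime,
      Set.mulIndicator {p : Nat.Primes | (p : ℕ) ∣ d} (fun p ↦ f p) p =
      ∏ p ∈ d.primeFactors, f p := by
    rw [← Finset.prod_subtype_of_mem f fun p hp ↦ Nat.prime_of_mem_primeFactors hp]
    refine Finset.prod_congr rfl fun p hp ↦ Set.mulIndicator_of_mem ?_ _
    exact Nat.dvd_of_mem_primeFactors (Finset.mem_subtype.mp hp)
  rw [← h]
  refine hasProd_prod_of_ne_finset_one fun p hp ↦ Set.mulIndicator_of_notMem (fun hd ↦ hp ?_) _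
  exact Finset.mem_subtype.mpr (Nat.mem_primeFactors.mpr ⟨p.2, hd, NeZero.ne d⟩)

/-- The functional equation of `eulerProd χ 1` for an arbitrary quadratic character, in a form
without denominators. -/
lemma eulerProd_two_mul_mul_zeta_mul_LFunction {d : ℕ} [NeZero d] (χ : DirichletCharacter ℂ d)
    (hχ : MulChar.IsQuadratic χ) {s : ℂ} (hs : 1 < s.re) :
    eulerProd χ 1 (2 * s) * (riemannZeta s * DirichletCharacter.LFunction χ s) =
      eulerProd χ 1 s ^ 2 * (riemannZeta (2 * s) * ∏ p ∈ d.primeFactors, (1 + (p : ℂ) ^ (-s))) := by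
  have hs2 : 1 < (2 * s).re := by
    simp only [mul_re, re_ofNat, im_ofNat, zero_mul, sub_zero]
    linarith
  have hL := DirichletCharacter.LSeries_eulerProduct_hasProd χ hs
  rw [← DirichletCharacter.LFunction_eq_LSeries χ hs] at hL
  have hl := (hasProd_eulerProd χ 1 hs2).mul ((riemannZeta_eulerProduct_hasProd hs).mul hL)
  have h1 := hasProd_eulerProd χ 1 hs
  have hr := (h1.mul h1).mul ((riemannZeta_eulerProduct_hasProd hs2).mul
    (hasProd_primeFactors (d := d) fun p ↦ 1 + (p : ℂ) ^ (-s)))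
  rw [sq]
  refine hl.unique (hr.congr_fun ?_)
  intro p
  have hdvd : (p : ℕ) ∣ d ↔ χ (p : ℕ) = 0 := by
    rw [← not_iff_not, ← ZMod.isUnit_prime_iff_not_dvd p.2]
    exact ⟨fun h ↦ (h.map χ).ne_zero, fun h ↦ by_contra fun hu ↦ h (χ.map_nonunit hu)⟩
  have hsq : ((p : ℕ) : ℂ) ^ (-(2 * s)) = (((p : ℕ) : ℂ) ^ (-s)) ^ 2 := by
    rw [← cpow_nat_mul]
    congr 1
    push_cast
    ring
  have hx := norm_prime_cpow_neg_le_half p hs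
  simp only [Set.mulIndicator_apply, Set.mem_ofPred_eq, hdvd, hsq]
  set x := ((p : ℕ) : ℂ) ^ (-s)
  have hsub : 1 - x ≠ 0 := fun h ↦ by
    rw [← sub_eq_zero.mp h, norm_one] at hx
    norm_num at hx
  have hadd : 1 + x ≠ 0 := fun h ↦ by
    rw [← neg_eq_of_add_eq_zero_right h, norm_neg, norm_one] at hx
    norm_num at hx
  rw [show 1 - x ^ 2 = (1 - x) * (1 + x) by ring]
  rcases hχ (p : ℕ) with h | h | h
  · norm_num [h]
    field_simp
  · norm_num [h]
    field_simp
  · norm_num [h]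
    field_simp

/-- The functional equation `p₁(2s) = p₁(s)² ⬝ q₁(s)` for `Re s > 1`. -/
theorem statement5 (K : Type*) [Field K] [NumberField K]
    (hK : Module.finrank ℚ K = 2) {d : ℕ} [NeZero d] (χ : DirichletCharacter ℂ d)
    (hχ : IsKroneckerCharacter K χ)
    (s : ℂ) (hs : 1 < s.re) :
    eulerProd χ 1 (2 * s) = eulerProd χ 1 s ^ 2 * qOne χ s := by
  have hL : DirichletCharacter.LFunction χ s ≠ 0 := by
    rw [DirichletCharacter.LFunction_eq_LSeries χ hs]
    exact DirichletCharacter.LSeries_ne_zero_of_one_lt_re χ hs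
  have hζ : riemannZeta s ≠ 0 := riemannZeta_ne_zero_of_one_lt_re hs
  have h := eulerProd_two_mul_mul_zeta_mul_LFunction χ hχ.2.2.1 hs
  rw [qOne, div_mul_eq_mul_div, ← mul_div_assoc, eq_div_iff (mul_ne_zero hζ hL), h]
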